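/- Suppose (F,∼) is a potential causality graph. Let σ_1 →^{u_1} σ_2 →^{u_2} ⋯ →^{u_k} σ_{k+1} be a walk with k ≥ 1, and write σ = σ_1. If either (a) u_k ∉ F_σ, or (b) k ≥ 2 and u_1 = u_k, then there exists an index i ∈ {1,…,k−1} such that u_i ∼ u_k. -/

import Mathlib

open scoped Classical

noncomputable section

namespace LLLFormal

/-- A walk: an initial state together with a list of (flaw, next-state) steps. -/
structure Walk (Ω F : Type*) where
  start : Ω
  steps : List (F × Ω)

variable {Ω F : Type*}

/-- Validity of a list of steps from a given state, w.r.t. a step relation. -/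
def ValidFrom (step : F → Ω → Ω → Prop) : Ω → List (F × Ω) → Prop
  | _, [] => True
  | σ, (f, σ') :: rest => step f σ σ' ∧ ValidFrom step σ' rest

/-- The state reached after performing the steps `l` starting from `σ`. -/
def endOf (σ : Ω) (l : List (F × Ω)) : Ω := (l.map Prod.snd).getLastD σ

/-- `τ` is a (valid) walk w.r.t. the step relation `step`. -/
def Walk.Valid (step : F → Ω → Ω → Prop) (τ : Walk Ω F) : Prop := ValidFrom step τ.start τ.steps

/-- The flaw word of a walk. -/
def Walk.word (τ : Walk Ω F) : List F := τ.steps.map Prod.fst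

/-- The final state of a walk. -/
def Walk.final (τ : Walk Ω F) : Ω := endOf τ.start τ.steps

/-- The length of a walk. -/
def Walk.len (τ : Walk Ω F) : ℕ := τ.steps.length

/-- Product of the transition probabilities along a list of steps. -/
def prodRho (ρ : F → Ω → Ω → ℝ) : Ω → List (F × Ω) → ℝ
  | _, [] => 1
  | σ, (f, σ') :: rest => ρ f σ σ' * prodRho ρ σ' rest

/-- The weight `p(τ)` of a walk. -/
def Walk.wt (ωinit : Ω → ℝ) (ρ : F → Ω → Ω → ℝ) (τ : Walk Ω F) : ℝ :=
  ωinit τ.start * prodRho ρ τ.start τ.steps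

/-- `λ_W = ∏_i λ_{w_i}`. -/
def wordWt (lam : F → ℝ) (W : List F) : ℝ := (W.map lam).prod

/-- The data of the objects, flaws, actions and resampling oracles:
`mem f σ` means `σ ∈ f`; `Act f σ` is the action set `A(f,σ)`;
`ρ f σ σ'` is the probability `ρ(σ'|f,σ)`, whose support is exactly `A(f,σ)`. -/
structure Setup (Ω F : Type*) [Fintype Ω] where
  mem : F → Ω → Prop
  flaw_nonempty : ∀ f, ∃ σ, mem f σ
  Act : F → Ω → Set Ω
  act_nonempty : ∀ f σ, mem f σ → (Act f σ).Nonempty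
  ρ : F → Ω → Ω → ℝ
  ρ_nonneg : ∀ f σ σ', 0 ≤ ρ f σ σ'
  ρ_support : ∀ f σ, mem f σ → ∀ σ', (0 < ρ f σ σ' ↔ σ' ∈ Act f σ)
  ρ_total : ∀ f σ, mem f σ → ∑ σ' : Ω, ρ f σ σ' = 1

variable [Fintype Ω]

/-- A valid step `σ →^f σ'`. -/
def Setup.step (S : Setup Ω F) (f : F) (σ σ' : Ω) : Prop := S.mem f σ ∧ σ' ∈ S.Act f σ

/-- A probability distribution on `Ω`. -/
def IsProb (ω : Ω → ℝ) : Prop := (∀ σ, 0 ≤ ω σ) ∧ ∑ σ : Ω, ω σ = 1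

/-- A probability distribution on `Ω` with full support. -/
def IsPosProb (ω : Ω → ℝ) : Prop := (∀ σ, 0 < ω σ) ∧ ∑ σ : Ω, ω σ = 1

/-- `γ^init = max_{σ∈Ω} ωinit σ / ω σ`. -/
def gammaInit [Nonempty Ω] (ωinit ω : Ω → ℝ) : ℝ :=
  Finset.univ.sup' Finset.univ_nonempty fun σ => ωinit σ / ω σ

/-- Condition (A): `λ_f ≥ ∑_{σ ∈ f : σ' ∈ A(f,σ)} ρ(σ'|f,σ) ω(σ)/ω(σ')`. -/
def CondA (S : Setup Ω F) (ω : Ω → ℝ) (lam : F → ℝ) : Prop :=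
  ∀ (f : F) (σ' : Ω),
    lam f ≥ ∑ σ : Ω, if S.mem f σ ∧ σ' ∈ S.Act f σ then S.ρ f σ σ' * ω σ / ω σ' else 0

/-- `(F, ∼)` is a potential causality graph:
for every valid step `σ →^f σ'`, `F_{σ'} ⊆ (F_σ − {f}) ∪ Γ(f)`. -/
def Causality (S : Setup Ω F) (sim : F → F → Prop) : Prop :=
  ∀ f σ σ', S.step f σ σ' → ∀ g, S.mem g σ' → (S.mem g σ ∧ g ≠ f) ∨ sim f g

/-- A finite set of flaws is independent. -/
def IndepF (sim : F → F → Prop) (I : Finset F) : Prop :=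
  ∀ f ∈ I, ∀ g ∈ I, f ≠ g → ¬ sim f g

/-- `B` is a partition of the word `W` into consecutive nonempty blocks of distinct,
pairwise non-neighbouring flaws, with each block contained in `Γ⁺` of the previous one. -/
def StablePartition (sim : F → F → Prop) (B : List (List F)) (W : List F) : Prop :=
  W = B.flatten ∧
  (∀ b ∈ B, b ≠ [] ∧ b.Nodup ∧ b.Pairwise fun f g => ¬ sim f g) ∧
  B.Chain' fun b₁ b₂ => ∀ g ∈ b₂, ∃ f ∈ b₁, f = g ∨ sim f g

/-- A stable word. -/
def StableWord (sim : F → F → Prop) (W : List F) : Prop := ∃ B, StablePartition sim B W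

/-- A stable partition whose blocks are listed in strictly increasing order. -/
def PiStablePartition [LinearOrder F] (sim : F → F → Prop) (B : List (List F))
    (W : List F) : Prop :=
  StablePartition sim B W ∧ ∀ b ∈ B, b.Chain' (· < ·)

/-- A π-stable word. -/
def PiStableWord [LinearOrder F] (sim : F → F → Prop) (W : List F) : Prop :=
  ∃ B, PiStablePartition sim B W

/-- A deterministic strategy: it assigns to every walk whose final state is flawed
a flaw present in the final state. -/
def IsStrategy (S : Setup Ω F) (Λ : Walk Ω F → F) : Prop :=
  ∀ τ : Walk Ω F, Walk.Valid S.step τ → (∃ f, S.mem f (Walk.final τ)) →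
    S.mem (Λ τ) (Walk.final τ)

/-- A walk follows the strategy `Λ`. -/
def Follows (Λ : Walk Ω F → F) (τ : Walk Ω F) : Prop :=
  ∀ (i : ℕ) (h : i < τ.steps.length),
    (τ.steps.get ⟨i, h⟩).1 = Λ ⟨τ.start, τ.steps.take i⟩

/-- The set `Bad(t)` of bad `t`-trajectories. -/
def Bad (S : Setup Ω F) (Λ : Walk Ω F → F) (ωinit : Ω → ℝ) (t : ℕ) : Set (Walk Ω F) :=
  {τ | Walk.Valid S.step τ ∧ Walk.len τ = t ∧ Follows Λ τ ∧ 0 < ωinit τ.start}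

/-- The cluster-expansion condition:
`(λ_f/μ_f) ∑_{S ∈ Ind(Γ(f))} μ(S) ≤ θ` for every flaw `f`. -/
def ClusterCond [Fintype F] (sim : F → F → Prop) (lam μ : F → ℝ) (θ : ℝ) : Prop :=
  ∀ f : F,
    lam f / μ f *
      ∑ I ∈ Finset.univ.filter (fun I : Finset F => (∀ g ∈ I, sim f g) ∧ IndepF sim I),
        ∏ g ∈ I, μ g ≤ θ

/-- `τ` is a prefix of `τ'`. -/
def Walk.IsPrefix (τ τ' : Walk Ω F) : Prop := τ.start = τ'.start ∧ τ.steps <+: τ'.steps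

/-- A valid set of walks: all walks follow one common deterministic strategy,
and no walk is a proper prefix of another one. -/
def ValidSet (S : Setup Ω F) (X : Set (Walk Ω F)) : Prop :=
  (∀ τ ∈ X, Walk.Valid S.step τ) ∧
  (∃ Λ : Walk Ω F → F, IsStrategy S Λ ∧ ∀ τ ∈ X, Follows Λ τ) ∧
  ∀ τ ∈ X, ∀ τ' ∈ X, Walk.IsPrefix τ τ' → τ = τ'

/-- Atomicity of the resampling oracles. -/
def Atomic (S : Setup Ω F) : Prop :=
  ∀ f σ' σ₁ σ₂, S.step f σ₁ σ' → S.step f σ₂ σ' → σ₁ = σ₂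

/-- The map `swap` sends every swappable pair of steps to a valid pair of steps. -/
def SwapValid (S : Setup Ω F) (sim : F → F → Prop) (swap : Ω → F → Ω → F → Ω → Ω) : Prop :=
  ∀ σ₁ f σ₂ g σ₃, S.step f σ₁ σ₂ → S.step g σ₂ σ₃ → ¬ sim f g →
    S.step g σ₁ (swap σ₁ f σ₂ g σ₃) ∧ S.step f (swap σ₁ f σ₂ g σ₃) σ₃

/-- The map `swap` is injective (as a map of two-step walks). -/
def SwapInj (S : Setup Ω F) (sim : F → F → Prop) (swap : Ω → F → Ω → F → Ω → Ω) : Prop :=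
  ∀ σ₁ f σ₂ τ₂ g σ₃, S.step f σ₁ σ₂ → S.step g σ₂ σ₃ → S.step f σ₁ τ₂ → S.step g τ₂ σ₃ →
    ¬ sim f g → swap σ₁ f σ₂ g σ₃ = swap σ₁ f τ₂ g σ₃ → σ₂ = τ₂

/-- The map `swap` preserves the product of the two transition probabilities. -/
def SwapProb (S : Setup Ω F) (sim : F → F → Prop) (swap : Ω → F → Ω → F → Ω → Ω) : Prop :=
  ∀ σ₁ f σ₂ g σ₃, S.step f σ₁ σ₂ → S.step g σ₂ σ₃ → ¬ sim f g →
    S.ρ f σ₁ σ₂ * S.ρ g σ₂ σ₃ =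
      S.ρ g σ₁ (swap σ₁ f σ₂ g σ₃) * S.ρ f (swap σ₁ f σ₂ g σ₃) σ₃

/-- `(ρ, ∼)` is weakly commutative. -/
def WeakComm (S : Setup Ω F) (sim : F → F → Prop) : Prop :=
  ∃ swap, SwapValid S sim swap ∧ SwapInj S sim swap

/-- `(ρ, ∼)` is strongly commutative. -/
def StrongComm (S : Setup Ω F) (sim : F → F → Prop) : Prop :=
  ∃ swap, SwapValid S sim swap ∧ SwapInj S sim swap ∧ SwapProb S sim swap

/-- One valid swap transforming the walk `τ` into the walk `τ'`. -/
def SwapStep (S : Setup Ω F) (sim : F → F → Prop) (swap : Ω → F → Ω → F → Ω → Ω)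
    (τ τ' : Walk Ω F) : Prop :=
  ∃ (A B : List (F × Ω)) (f g : F) (σ₂ σ₃ : Ω),
    f ≠ g ∧ ¬ sim f g ∧
    S.step f (endOf τ.start A) σ₂ ∧ S.step g σ₂ σ₃ ∧
    τ.steps = A ++ (f, σ₂) :: (g, σ₃) :: B ∧
    τ' = ⟨τ.start, A ++ (g, swap (endOf τ.start A) f σ₂ g σ₃) :: (f, σ₃) :: B⟩

/-- `U` is a chain of the walk `τ`. -/
def IsChainOf (sim : F → F → Prop) (U : List F) (τ : Walk Ω F) : Prop :=
  U.Sublist (Walk.word τ) ∧ U.Chain' fun a b => a = b ∨ sim a b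

/-- The longest prefix of `W` ending with `f` (empty if `f` does not occur in `W`). -/
def prefEnd (f : F) (W : List F) : List F :=
  (W.reverse.dropWhile fun x => decide (x ≠ f)).reverse

/-- `W^f_τ` for `f ∈ F ∪ {∅}`. -/
def prefOpt (fo : Option F) (W : List F) : List F :=
  match fo with
  | none => W
  | some f => prefEnd f W

/-- `g ∈ Γ⁺(I)` for a list `I` of flaws. -/
def GammaPlusL (sim : F → F → Prop) (I : List F) (g : F) : Prop := ∃ f ∈ I, f = g ∨ sim f g

/-- The steps of one round, starting at state `σ` with already-addressed flaws `I`: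
each addressed flaw `f` satisfies `f ∈ F_σ − Γ⁺(I)` and the step is valid. -/
def RoundFrom (S : Setup Ω F) (sim : F → F → Prop) : Ω → List F → List (F × Ω) → Prop
  | _, _, [] => True
  | σ, I, (f, σ') :: rest =>
      S.mem f σ ∧ ¬ GammaPlusL sim I f ∧ σ' ∈ S.Act f σ ∧
      RoundFrom S sim σ' (I ++ [f]) rest

/-- Like `RoundFrom`, but the addressed flaw is moreover the `≼`-least of `F_σ − Γ⁺(I)`. -/
def RoundFromPi [LinearOrder F] (S : Setup Ω F) (sim : F → F → Prop) :
    Ω → List F → List (F × Ω) → Prop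
  | _, _, [] => True
  | σ, I, (f, σ') :: rest =>
      S.mem f σ ∧ ¬ GammaPlusL sim I f ∧
      (∀ g, S.mem g σ → ¬ GammaPlusL sim I g → f ≤ g) ∧
      σ' ∈ S.Act f σ ∧ RoundFromPi S sim σ' (I ++ [f]) rest

/-- A walk grouped into rounds: each round is valid, and at the final state of every
round except possibly the last one, `F_σ − Γ⁺(I_r) = ∅`. -/
def RoundsFrom (S : Setup Ω F) (sim : F → F → Prop) : Ω → List (List (F × Ω)) → Prop
  | _, [] => True
  | σ, b :: rest =>
      RoundFrom S sim σ [] b ∧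
      (rest = [] ∨
        ((∀ g, S.mem g (endOf σ b) → GammaPlusL sim (b.map Prod.fst) g) ∧
          RoundsFrom S sim (endOf σ b) rest))

/-- Like `RoundsFrom`, with the `≼`-least flaw selection rule. -/
def RoundsFromPi [LinearOrder F] (S : Setup Ω F) (sim : F → F → Prop) :
    Ω → List (List (F × Ω)) → Prop
  | _, [] => True
  | σ, b :: rest =>
      RoundFromPi S sim σ [] b ∧
      (rest = [] ∨
        ((∀ g, S.mem g (endOf σ b) → GammaPlusL sim (b.map Prod.fst) g) ∧
          RoundsFromPi S sim (endOf σ b) rest))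

/-- The family `Ind^init = ∪_{σ : ωinit σ > 0} Ind(F_σ)`. -/
def indInitSets [Fintype F] (S : Setup Ω F) (sim : F → F → Prop) (ωinit : Ω → ℝ) :
    Finset (Finset F) :=
  Finset.univ.filter fun R => IndepF sim R ∧ ∃ σ, 0 < ωinit σ ∧ ∀ f ∈ R, S.mem f σ

/-- `λ_φ` for a sequence of sets of flaws. -/
def seqWt (lam : F → ℝ) (φ : List (Finset F)) : ℝ := (φ.map fun I => ∏ f ∈ I, lam f).prod

/-- `|φ| = ∑_r |I_r|`. -/
def seqSize (φ : List (Finset F)) : ℕ := (φ.map Finset.card).sum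

/-- A strongly stable sequence. -/
def StronglyStableSeq (sim : F → F → Prop) (φ : List (Finset F)) : Prop :=
  φ ≠ [] ∧ (∀ I ∈ φ, IndepF sim I) ∧
  φ.Chain' (fun I J => ∀ g ∈ J, ∃ f ∈ I, sim f g) ∧
  ∀ I ∈ φ.tail, I ≠ ∅

/-- Membership in `Stab(R,S,t,ℓ)`. -/
def StabRSTL (sim : F → F → Prop) (R S : Finset F) (t ℓ : ℕ) (φ : List (Finset F)) : Prop :=
  φ.head? = some R ∧ φ.length ≤ ℓ ∧ t ≤ seqSize φ ∧
  ((φ.length = 1 ∧ S = ∅) ∨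
    (2 ≤ φ.length ∧ S = φ.tail.headI.filter (fun g => ¬ ∃ f ∈ R, sim f g) ∧
      StronglyStableSeq sim φ.tail))

/-- One valid swap on words. -/
def WordSwap (sim : F → F → Prop) (W W' : List F) : Prop :=
  ∃ (A B : List F) (f g : F), f ≠ g ∧ ¬ sim f g ∧ W = A ++ f :: g :: B ∧ W' = A ++ g :: f :: B

end LLLFormal

namespace LLLFormal

/-- If the flaw addressed at position `n` of a valid walk is absent from the initial state, or is
also the flaw addressed first, then some flaw addressed before position `n` causes it. -/
theorem ValidFrom.exists_sim_getElem {Ω F : Type*} [Fintype Ω] {S : Setup Ω F}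
    {sim : F → F → Prop} (hcaus : Causality S sim) {steps : List (F × Ω)} {σ : Ω}
    (hvalid : ValidFrom S.step σ steps) {n : ℕ} (hn : n < steps.length)
    (hcase : ¬ S.mem steps[n].1 σ ∨ 0 < n ∧ steps[0].1 = steps[n].1) :
    ∃ i, ∃ _h : i < n, sim steps[i].1 steps[n].1 := by
  induction steps generalizing σ n with
  | nil => simp at hn
  | cons a rest ih =>
    obtain ⟨f, σ'⟩ := a
    obtain ⟨hstep, hrest⟩ := hvalid
    cases n with
    | zero => simp [hstep.1] at hcase
    | succ n =>
      simp only [List.length_cons, Nat.add_lt_add_iff_right] at hn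
      simp only [List.getElem_cons_succ, List.getElem_cons_zero] at hcase ⊢
      by_cases hmem : S.mem rest[n].1 σ'
      · rcases hcaus f σ σ' hstep _ hmem with ⟨hσ, hne⟩ | hsim
        · rcases hcase with hσ' | ⟨_, heq⟩
          · exact absurd hσ hσ'
          · exact absurd heq.symm hne
        · exact ⟨0, n.succ_pos, by simpa using hsim⟩
      · obtain ⟨i, hi, hsim⟩ := ih hrest hn (Or.inl hmem)
        exact ⟨i + 1, Nat.succ_lt_succ hi, by simpa using hsim⟩

/-- technical lemma: if `(F,∼)` is a potential causality graph and
`σ →^{u_1} ⋯ →^{u_k} σ_{k+1}` is a walk with `k ≥ 1` such that either `u_k` is not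
present in `σ`, or `k ≥ 2` and `u_1 = u_k`, then `u_i ∼ u_k` for some `i ∈ [k-1]`. -/
theorem stmt_1 {Ω F : Type*} [Fintype Ω]
    (S : Setup Ω F) (sim : F → F → Prop) (hsym : Symmetric sim) (hcaus : Causality S sim)
    (σ : Ω) (steps : List (F × Ω)) (hvalid : ValidFrom S.step σ steps)
    (hk : 1 ≤ steps.length)
    (hcase : ¬ S.mem (steps.get ⟨steps.length - 1, by omega⟩).1 σ ∨
      (2 ≤ steps.length ∧
        (steps.get ⟨0, by omega⟩).1 = (steps.get ⟨steps.length - 1, by omega⟩).1)) :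
    ∃ i, ∃ _h : i < steps.length - 1,
      sim (steps.get ⟨i, by omega⟩).1 (steps.get ⟨steps.length - 1, by omega⟩).1 := by
  exact hvalid.exists_sim_getElem hcaus (n := steps.length - 1) (by omega)
    (hcase.imp id fun h => ⟨by omega, h.2⟩)

end LLLFormal
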